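/- Let 𝒪 ⊂ ℝ^{m−k} × ℝ^n be open, let φ : 𝒪 → ℝᵏ, and suppose that for every A ∈ 𝒪 a real k×(m−k) matrix M(A) is given which satisfies the uniform intrinsic differentiability condition of φ at A. Then the map A ↦ M(A) is continuous on 𝒪. -/

import Mathlib

noncomputable section

open Set Filter Topology MeasureTheory

namespace Carnot

/-- Euclidean norm on `Fin d → ℝ`. -/
def enorm {d : ℕ} (x : Fin d → ℝ) : ℝ := Real.sqrt (∑ i, (x i) ^ 2)

/-- The underlying set of the Carnot group `G = ℝ^m × ℝ^n` of class `𝓑`. -/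
abbrev G (m n : ℕ) := (Fin m → ℝ) × (Fin n → ℝ)

/-- Points of the normal complement `W`, identified with `ℝ^(m-k) × ℝ^n`. -/
abbrev W (m n k : ℕ) := (Fin (m - k) → ℝ) × (Fin n → ℝ)

/-- The group law of the Carnot group of class `𝓑` associated with the
skew-symmetric matrices `b s`:
`(x,y)·(x',y') = (x + x', y + y' + ½⟨Bx,x'⟩)`. -/
def gmul {m n : ℕ} (b : Fin n → Matrix (Fin m) (Fin m) ℝ) (P Q : G m n) : G m n :=
  (P.1 + Q.1, fun s => P.2 s + Q.2 s + (1 / 2) * ∑ i, ∑ j, b s i j * P.1 j * Q.1 i)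

/-- The group inverse `(x,y)⁻¹ = (-x,-y)`. -/
def ginv {m n : ℕ} (P : G m n) : G m n := (-P.1, -P.2)

/-- The homogeneous quasi-norm `N(x,y) = |x| + |y|^(1/2)`. -/
def qnorm {m n : ℕ} (P : G m n) : ℝ := enorm P.1 + Real.sqrt (enorm P.2)

/-- Open ball for the quasi-norm: `U(P,r) = {Q : N(P⁻¹·Q) < r}`. -/
def ball (m n : ℕ) (b : Fin n → Matrix (Fin m) (Fin m) ℝ) (P : G m n) (r : ℝ) : Set (G m n) :=
  {Q | qnorm (gmul b (ginv P) Q) < r}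

/-- The embedding `i : ℝ^(m-k) × ℝ^n → G`, `i(a,α) = (0,…,0,a,α)`. -/
def embW (m n k : ℕ) (A : W m n k) : G m n :=
  (fun j => if h : (j : ℕ) < k then 0 else A.1 ⟨(j : ℕ) - k, by have := j.isLt; omega⟩, A.2)

/-- The embedding of `ℝ^k` as the horizontal subgroup `H`, `v ↦ (v,0,…,0)`. -/
def embH (m n k : ℕ) (v : Fin k → ℝ) : G m n :=
  (fun j => if h : (j : ℕ) < k then v ⟨(j : ℕ), h⟩ else 0, 0)

/-- The graph map `Φ(A) = i(A)·φ̂(A)`. -/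
def graphMap (m n k : ℕ) (b : Fin n → Matrix (Fin m) (Fin m) ℝ)
    (φ : W m n k → Fin k → ℝ) (A : W m n k) : G m n :=
  gmul b (embW m n k A) (embH m n k (φ A))

/-- `N(i(A)⁻¹·i(B))`. -/
def dW (m n k : ℕ) (b : Fin n → Matrix (Fin m) (Fin m) ℝ) (A B : W m n k) : ℝ :=
  qnorm (gmul b (ginv (embW m n k A)) (embW m n k B))

/-- The graph quasi-distance `σ_φ(A,B) = N(φ̂(A)⁻¹·i(A)⁻¹·i(B)·φ̂(A))`. -/
def sigma (m n k : ℕ) (b : Fin n → Matrix (Fin m) (Fin m) ℝ)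
    (φ : W m n k → Fin k → ℝ) (A B : W m n k) : ℝ :=
  qnorm (gmul b (gmul b (gmul b (ginv (embH m n k (φ A))) (ginv (embW m n k A)))
    (embW m n k B)) (embH m n k (φ A)))

/-- The matrix `M` satisfies the uniform intrinsic differentiability condition of `φ`
at `A₀ ∈ 𝒪`. -/
def UID (m n k : ℕ) (b : Fin n → Matrix (Fin m) (Fin m) ℝ) (O : Set (W m n k))
    (φ : W m n k → Fin k → ℝ) (A₀ : W m n k) (M : Matrix (Fin k) (Fin (m - k)) ℝ) : Prop :=
  ∀ ε > 0, ∃ r > 0, ∀ A ∈ O, ∀ B ∈ O,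
    dW m n k b A₀ A < r → dW m n k b A B < r → 0 < dW m n k b A B →
    enorm (fun j => φ B j - φ A j - ∑ i, M j i * (B.1 i - A.1 i)) ≤ ε * sigma m n k b φ A B

/-- `f : U → ℝ^k` is of class `C¹_G` with (continuous) horizontal Jacobian `gradf`. -/
def C1G (m n k : ℕ) (b : Fin n → Matrix (Fin m) (Fin m) ℝ) (U : Set (G m n))
    (f : G m n → Fin k → ℝ) (gradf : G m n → Matrix (Fin k) (Fin m) ℝ) : Prop :=
  ContinuousOn f U ∧ ContinuousOn gradf U ∧
  ∀ P ∈ U, ∀ ε > 0, ∃ r > 0, ∀ Q ∈ U,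
    qnorm (gmul b (ginv P) Q) < r →
    enorm (fun j => f Q j - f P j - ∑ i, gradf P j i * (Q.1 i - P.1 i)) ≤
      ε * qnorm (gmul b (ginv P) Q)

/-- The square block `M₁(Q) = (X_i f_j(Q))_{j,i=1,…,k}` of the horizontal Jacobian. -/
def M1 (m n k : ℕ) (hk : k ≤ m) (gradf : G m n → Matrix (Fin k) (Fin m) ℝ) (Q : G m n) :
    Matrix (Fin k) (Fin k) ℝ :=
  Matrix.of fun j i => gradf Q j (Fin.castLE hk i)

/-- The block `M₂(Q) = (X_{k+i} f_j(Q))_{j=1,…,k; i=1,…,m-k}` of the horizontal Jacobian. -/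
def M2 (m n k : ℕ) (gradf : G m n → Matrix (Fin k) (Fin m) ℝ) (Q : G m n) :
    Matrix (Fin k) (Fin (m - k)) ℝ :=
  Matrix.of fun j i => gradf Q j ⟨k + (i : ℕ), by have := i.isLt; omega⟩

theorem abs_le_enorm {d : ℕ} (x : Fin d → ℝ) (j : Fin d) : |x j| ≤ enorm x := by
  rw [← Real.sqrt_sq_eq_abs]
  exact Real.sqrt_le_sqrt
    (Finset.single_le_sum (f := fun i => x i ^ 2) (fun i _ => sq_nonneg _) (Finset.mem_univ j))

@[simp] theorem enorm_zero {d : ℕ} : enorm (0 : Fin d → ℝ) = 0 := by simp [enorm]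

theorem enorm_single {d : ℕ} (i : Fin d) (t : ℝ) : enorm (Pi.single i t) = |t| := by
  have h : ∀ j : Fin d, (Pi.single i t : Fin d → ℝ) j ^ 2 = if j = i then t ^ 2 else 0 := by
    intro j
    by_cases hj : j = i <;> simp [hj]
  simp [enorm, h, Real.sqrt_sq_eq_abs]

@[fun_prop] theorem continuous_enorm {d : ℕ} : Continuous (enorm : (Fin d → ℝ) → ℝ) := by
  unfold enorm; fun_prop

@[fun_prop] theorem continuous_qnorm {m n : ℕ} : Continuous (qnorm : G m n → ℝ) := by
  unfold qnorm; fun_prop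

theorem continuous_embW (m n k : ℕ) : Continuous (embW m n k) := by
  unfold embW
  refine Continuous.prodMk (continuous_pi fun j => ?_) continuous_snd
  split_ifs <;> fun_prop

theorem continuous_gmul_right {m n : ℕ} (b : Fin n → Matrix (Fin m) (Fin m) ℝ) (P : G m n) :
    Continuous fun Q => gmul b P Q := by
  unfold gmul; fun_prop

theorem continuous_gmul_left {m n : ℕ} (b : Fin n → Matrix (Fin m) (Fin m) ℝ) (Q : G m n) :
    Continuous fun P => gmul b P Q := by
  unfold gmul; fun_prop

theorem continuous_dW (m n k : ℕ) (b : Fin n → Matrix (Fin m) (Fin m) ℝ) (A : W m n k) :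
    Continuous fun B => dW m n k b A B :=
  continuous_qnorm.comp ((continuous_gmul_right b _).comp (continuous_embW m n k))

theorem sum_sum_mul_eq_dotProduct {m : ℕ} (C : Matrix (Fin m) (Fin m) ℝ) (x y : Fin m → ℝ) :
    ∑ i, ∑ j, C i j * x j * y i = y ⬝ᵥ C.mulVec x := by
  simp only [dotProduct, Matrix.mulVec, Finset.mul_sum]
  exact Finset.sum_congr rfl fun i _ => Finset.sum_congr rfl fun j _ => by ring

theorem dotProduct_mulVec_self_of_skew {m : ℕ} {C : Matrix (Fin m) (Fin m) ℝ}
    (hC : C.transpose = -C) (x : Fin m → ℝ) : x ⬝ᵥ C.mulVec x = 0 := by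
  have h : x ⬝ᵥ C.mulVec x = -(x ⬝ᵥ C.mulVec x) := by
    conv_lhs => rw [Matrix.dotProduct_mulVec, ← Matrix.mulVec_transpose, hC, dotProduct_comm,
      Matrix.neg_mulVec, dotProduct_neg]
  linarith

theorem gmul_ginv_self {m n : ℕ} {b : Fin n → Matrix (Fin m) (Fin m) ℝ}
    (hskew : ∀ s, (b s).transpose = -(b s)) (P : G m n) : gmul b (ginv P) P = 0 := by
  unfold gmul ginv
  ext s
  · simp
  · simp only [sum_sum_mul_eq_dotProduct, Matrix.mulVec_neg, dotProduct_neg,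
      dotProduct_mulVec_self_of_skew (hskew s)]
    simp

theorem dW_self {m n k : ℕ} {b : Fin n → Matrix (Fin m) (Fin m) ℝ}
    (hskew : ∀ s, (b s).transpose = -(b s)) (A : W m n k) : dW m n k b A A = 0 := by
  simp [dW, gmul_ginv_self hskew, qnorm]

theorem embW_add_single_fst (m n k : ℕ) (a : Fin (m - k) → ℝ) (α β : Fin n → ℝ)
    (i : Fin (m - k)) (t : ℝ) :
    (embW m n k (a + Pi.single i t, β)).1 =
      (embW m n k (a, α)).1 + Pi.single ⟨k + (i : ℕ), by have := i.isLt; omega⟩ t := by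
  ext j
  simp only [embW, Pi.add_apply, Pi.single_apply, Fin.ext_iff]
  split_ifs <;> first | omega | simp

/-- `φ̂(A)⁻¹·i(A)⁻¹·i(B)·φ̂(A)` with `v = φ(A)`. -/
def conjDiff (m n k : ℕ) (b : Fin n → Matrix (Fin m) (Fin m) ℝ) (v : Fin k → ℝ)
    (A B : W m n k) : G m n :=
  gmul b (gmul b (gmul b (ginv (embH m n k v)) (ginv (embW m n k A))) (embW m n k B))
    (embH m n k v)

theorem continuous_conjDiff (m n k : ℕ) (b : Fin n → Matrix (Fin m) (Fin m) ℝ) (v : Fin k → ℝ)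
    (A : W m n k) : Continuous fun B => conjDiff m n k b v A B :=
  (continuous_gmul_left b _).comp
    ((continuous_gmul_right b _).comp (continuous_embW m n k))

theorem conjDiff_fst (m n k : ℕ) (b : Fin n → Matrix (Fin m) (Fin m) ℝ) (v : Fin k → ℝ)
    (A B : W m n k) :
    (conjDiff m n k b v A B).1 = (embW m n k B).1 - (embW m n k A).1 := by
  simp only [conjDiff, gmul, ginv]
  abel

theorem conjDiff_snd (m n k : ℕ) (b : Fin n → Matrix (Fin m) (Fin m) ℝ) (v : Fin k → ℝ)
    (A : W m n k) (a : Fin (m - k) → ℝ) (β : Fin n → ℝ) :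
    (conjDiff m n k b v A (a, β)).2 = β + (conjDiff m n k b v A (a, 0)).2 := by
  ext s
  simp only [conjDiff, gmul, ginv, embW, embH, Pi.add_apply, Pi.zero_apply]
  ring

theorem conjDiff_self_snd {m n k : ℕ} {b : Fin n → Matrix (Fin m) (Fin m) ℝ}
    (hskew : ∀ s, (b s).transpose = -(b s)) (v : Fin k → ℝ) (A : W m n k) :
    (conjDiff m n k b v A A).2 = 0 := by
  ext s
  simp only [conjDiff, gmul, ginv, sum_sum_mul_eq_dotProduct]
  simp [Matrix.mulVec_add, Matrix.mulVec_neg, dotProduct_mulVec_self_of_skew (hskew s), embH]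

/-- Translate of `A` by `t` in the `i`-th horizontal direction of `W`, with the vertical part
chosen so that the vertical part of `φ̂(A)⁻¹·i(A)⁻¹·i(B)·φ̂(A)` vanishes. -/
def horizShift (m n k : ℕ) (b : Fin n → Matrix (Fin m) (Fin m) ℝ) (v : Fin k → ℝ)
    (A : W m n k) (i : Fin (m - k)) (t : ℝ) : W m n k :=
  (A.1 + Pi.single i t, -(conjDiff m n k b v A (A.1 + Pi.single i t, 0)).2)

theorem continuous_horizShift (m n k : ℕ) (b : Fin n → Matrix (Fin m) (Fin m) ℝ)
    (v : Fin k → ℝ) (A : W m n k) (i : Fin (m - k)) :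
    Continuous (horizShift m n k b v A i) := by
  have h : Continuous fun t : ℝ => A.1 + (Pi.single i t : Fin (m - k) → ℝ) :=
    continuous_const.add (continuous_single (A := fun _ => ℝ) i)
  exact h.prodMk (continuous_snd.comp
    ((continuous_conjDiff m n k b v A).comp (h.prodMk continuous_const))).neg

theorem horizShift_zero {m n k : ℕ} {b : Fin n → Matrix (Fin m) (Fin m) ℝ}
    (hskew : ∀ s, (b s).transpose = -(b s)) (v : Fin k → ℝ) (A : W m n k) (i : Fin (m - k)) :
    horizShift m n k b v A i 0 = A := by
  have h := conjDiff_snd m n k b v A A.1 A.2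
  rw [Prod.mk.eta, conjDiff_self_snd hskew] at h
  refine Prod.ext (by simp [horizShift]) ?_
  simp only [horizShift, Pi.single_zero, add_zero]
  exact (eq_neg_of_add_eq_zero_left h.symm).symm

theorem sigma_horizShift (m n k : ℕ) (b : Fin n → Matrix (Fin m) (Fin m) ℝ)
    (φ : W m n k → Fin k → ℝ) (A : W m n k) (i : Fin (m - k)) (t : ℝ) :
    sigma m n k b φ A (horizShift m n k b (φ A) A i t) = |t| := by
  change qnorm (conjDiff m n k b (φ A) A _) = |t|
  have h : (conjDiff m n k b (φ A) A (horizShift m n k b (φ A) A i t)).2 = 0 := by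
    rw [horizShift, conjDiff_snd, neg_add_cancel]
  rw [qnorm, h, conjDiff_fst, horizShift, embW_add_single_fst m n k A.1 A.2]
  simp [enorm_single]

theorem dW_horizShift_pos (m n k : ℕ) (b : Fin n → Matrix (Fin m) (Fin m) ℝ)
    (v : Fin k → ℝ) (A : W m n k) (i : Fin (m - k)) {t : ℝ} (ht : 0 < t) :
    0 < dW m n k b A (horizShift m n k b v A i t) := by
  refine add_pos_of_pos_of_nonneg ?_ (Real.sqrt_nonneg _)
  simp only [gmul, ginv, horizShift]
  rw [embW_add_single_fst m n k A.1 A.2]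
  simpa [enorm_single] using ht.ne'

/-- Two matrices that both approximate the increments of `φ` based at `A` have close entries. -/
theorem abs_entry_sub_le {m n k : ℕ} {b : Fin n → Matrix (Fin m) (Fin m) ℝ}
    (hskew : ∀ s, (b s).transpose = -(b s)) {O : Set (W m n k)} (hO : IsOpen O)
    {φ : W m n k → Fin k → ℝ} {A : W m n k} (hA : A ∈ O)
    {M N : Matrix (Fin k) (Fin (m - k)) ℝ} {r ε : ℝ} (hr : 0 < r)
    (hM : ∀ B ∈ O, dW m n k b A B < r → 0 < dW m n k b A B →
      enorm (fun j => φ B j - φ A j - ∑ i, M j i * (B.1 i - A.1 i)) ≤ ε * sigma m n k b φ A B)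
    (hN : ∀ B ∈ O, dW m n k b A B < r → 0 < dW m n k b A B →
      enorm (fun j => φ B j - φ A j - ∑ i, N j i * (B.1 i - A.1 i)) ≤ ε * sigma m n k b φ A B)
    (j : Fin k) (i : Fin (m - k)) : |M j i - N j i| ≤ 2 * ε := by
  have hc := continuous_horizShift m n k b (φ A) A i
  have h0 := horizShift_zero hskew (φ A) A i
  have hmem : ∀ᶠ t in 𝓝[>] (0 : ℝ), horizShift m n k b (φ A) A i t ∈ O :=
    (hc.tendsto 0).mono_left nhdsWithin_le_nhds (hO.mem_nhds (by rwa [h0]))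
  have hnear : ∀ᶠ t in 𝓝[>] (0 : ℝ), dW m n k b A (horizShift m n k b (φ A) A i t) < r := by
    refine ((((continuous_dW m n k b A).comp hc).tendsto 0).mono_left
      nhdsWithin_le_nhds).eventually_lt_const ?_
    simpa [h0, dW_self hskew] using hr
  obtain ⟨t, ⟨htO, htr⟩, ht⟩ := ((hmem.and hnear).and self_mem_nhdsWithin).exists
  have ht : 0 < t := ht
  have hpos := dW_horizShift_pos m n k b (φ A) A i ht
  have key : ∀ L : Matrix (Fin k) (Fin (m - k)) ℝ,
      ∑ l, L j l * ((horizShift m n k b (φ A) A i t).1 l - A.1 l) = L j i * t := by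
    intro L
    simp [horizShift, Pi.single_apply]
  have h1 := (abs_le_enorm _ j).trans (hM _ htO htr hpos)
  have h2 := (abs_le_enorm _ j).trans (hN _ htO htr hpos)
  simp only [key, sigma_horizShift, abs_of_pos ht] at h1 h2
  have h3 : |M j i - N j i| * t ≤ 2 * ε * t := by
    calc |M j i - N j i| * t = |(M j i - N j i) * t| := by rw [abs_mul, abs_of_pos ht]
      _ ≤ 2 * ε * t := by
        rw [abs_le] at h1 h2 ⊢
        constructor <;> linarith [h1.1, h1.2, h2.1, h2.2]
  exact le_of_mul_le_mul_right h3 ht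

/-- If for every `A ∈ 𝒪` a matrix `M(A)` satisfying the uniform
intrinsic differentiability condition of `φ` at `A` is given, then `A ↦ M(A)` is
continuous on `𝒪`. -/
theorem statement3 (m n k : ℕ) (hm : 2 ≤ m) (hn : 1 ≤ n) (hk : 1 ≤ k) (hkm : k < m)
    (b : Fin n → Matrix (Fin m) (Fin m) ℝ)
    (hskew : ∀ s, (b s).transpose = -(b s)) (hind : LinearIndependent ℝ b)
    (hblock : ∀ s (i j : Fin m), (i : ℕ) < k → (j : ℕ) < k → b s i j = 0)
    (O : Set (W m n k)) (hO : IsOpen O) (φ : W m n k → Fin k → ℝ)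
    (M : W m n k → Matrix (Fin k) (Fin (m - k)) ℝ)
    (huid : ∀ A ∈ O, UID m n k b O φ A (M A)) :
    ContinuousOn M O := by
  refine continuousOn_pi.2 fun j => continuousOn_pi.2 fun i => fun A₀ hA₀ => ?_
  refine Metric.tendsto_nhds.2 fun ε hε => ?_
  obtain ⟨r, hr, h⟩ := huid A₀ hA₀ (ε / 3) (by positivity)
  have hnear : ∀ᶠ A in 𝓝[O] A₀, dW m n k b A₀ A < r := by
    refine (((continuous_dW m n k b A₀).tendsto A₀).mono_left
      nhdsWithin_le_nhds).eventually_lt_const ?_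
    simpa [dW_self hskew] using hr
  filter_upwards [hnear, self_mem_nhdsWithin] with A hAr hA
  obtain ⟨r', hr', h'⟩ := huid A hA (ε / 3) (by positivity)
  have hle := abs_entry_sub_le hskew hO hA (lt_min hr hr')
    (fun B hB hd hp => h' A hA B hB (by rwa [dW_self hskew]) (hd.trans_le (min_le_right _ _)) hp)
    (fun B hB hd hp => h A hA B hB hAr (hd.trans_le (min_le_left _ _)) hp) j i
  rw [Real.dist_eq]
  linarith

end Carnot
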